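/- arXiv:2010.04619 — 4 statements merged into one kernel-verified Lean document; each statement's English description precedes it below -/
import Mathlib

section
/- Let ε ∈ [0,1) and T, S ∈ B(H). If T is self-adjoint (T = T*) and T ⊥ε_ω S, then T is approximately Birkhoff–James orthogonal to S, i.e., ‖T + λS‖² ≥ ‖T‖² − 2ε‖T‖‖λS‖ for all λ ∈ ℂ. -/
open Filter Topology
open scoped InnerProductSpace

variable {H : Type*} [NormedAddCommGroup H] [InnerProductSpace ℂ H] [CompleteSpace H]

/-- The numerical radius of a bounded operator `T`:
`ω(T) = sup {|⟨Tx, x⟩| : ‖x‖ = 1}`. -/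
noncomputable def nrad (T : H →L[ℂ] H) : ℝ :=
  sSup {r : ℝ | ∃ x : H, ‖x‖ = 1 ∧ r = ‖⟪x, T x⟫_ℂ‖}

/-- Approximate numerical-radius (Birkhoff) orthogonality:
`T ⊥ε_ω S` iff `ω(T + λS)² ≥ ω(T)² − 2ε ω(T) ω(λS)` for all `λ ∈ ℂ`. -/
def NradOrth (ε : ℝ) (T S : H →L[ℂ] H) : Prop :=
  ∀ μ : ℂ, nrad T ^ 2 - 2 * ε * nrad T * nrad (μ • S) ≤ nrad (T + μ • S) ^ 2

theorem norm_inner_apply_self_le (A : H →L[ℂ] H) {x : H} (hx : ‖x‖ = 1) :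
    ‖⟪x, A x⟫_ℂ‖ ≤ ‖A‖ := by
  grw [norm_inner_le_norm, A.le_opNorm, hx, one_mul, mul_one]

theorem norm_inner_apply_self_le_nrad (A : H →L[ℂ] H) {x : H} (hx : ‖x‖ = 1) :
    ‖⟪x, A x⟫_ℂ‖ ≤ nrad A := by
  refine le_csSup ⟨‖A‖, ?_⟩ ⟨x, hx, rfl⟩
  rintro r ⟨y, hy, rfl⟩
  exact norm_inner_apply_self_le A hy

theorem nrad_nonneg (A : H →L[ℂ] H) : 0 ≤ nrad A := by
  refine Real.sSup_nonneg ?_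
  rintro r ⟨x, -, rfl⟩
  exact norm_nonneg _

theorem nrad_le_norm (A : H →L[ℂ] H) : nrad A ≤ ‖A‖ := by
  refine Real.sSup_le ?_ (norm_nonneg A)
  rintro r ⟨x, hx, rfl⟩
  exact norm_inner_apply_self_le A hx

theorem abs_rayleighQuotient_le_nrad (A : H →L[ℂ] H) (x : H) :
    |A.rayleighQuotient x| ≤ nrad A := by
  by_cases hx : x = 0
  · simp [hx, nrad_nonneg]
  obtain ⟨y, hy, hxy⟩ : A.rayleighQuotient x ∈ A.rayleighQuotient '' Metric.sphere 0 1 :=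
    A.image_rayleigh_eq_image_rayleigh_sphere one_pos ▸ Set.mem_image_of_mem _ hx
  rw [mem_sphere_zero_iff_norm] at hy
  rw [← hxy, ContinuousLinearMap.rayleighQuotient, hy, one_pow, div_one,
    ContinuousLinearMap.reApplyInnerSelf_apply]
  grw [RCLike.abs_re_le_norm, norm_inner_symm, norm_inner_apply_self_le_nrad A hy]

theorem IsSelfAdjoint.nrad_eq_norm {A : H →L[ℂ] H} (hA : IsSelfAdjoint A) :
    nrad A = ‖A‖ := by
  refine le_antisymm (nrad_le_norm A) ?_
  rw [A.norm_eq_iSup_rayleighQuotient hA.isSymmetric]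
  exact ciSup_le (abs_rayleighQuotient_le_nrad A)

/-- If `T` is self-adjoint and `T ⊥ε_ω S`, then `T` is approximately
Birkhoff--James orthogonal to `S`: `‖T + λS‖² ≥ ‖T‖² − 2ε‖T‖‖λS‖` for all `λ ∈ ℂ`. -/
theorem nradOrth_selfAdjoint_implies_BJ (ε : ℝ) (hε0 : 0 ≤ ε) (hε1 : ε < 1)
    (T S : H →L[ℂ] H) (hT : IsSelfAdjoint T) (h : NradOrth ε T S) :
    ∀ μ : ℂ, ‖T‖ ^ 2 - 2 * ε * ‖T‖ * ‖μ • S‖ ≤ ‖T + μ • S‖ ^ 2 := by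
  intro μ
  calc ‖T‖ ^ 2 - 2 * ε * ‖T‖ * ‖μ • S‖
      ≤ ‖T‖ ^ 2 - 2 * ε * ‖T‖ * nrad (μ • S) := by
        gcongr
        exact nrad_le_norm _
    _ ≤ nrad (T + μ • S) ^ 2 := by simpa only [hT.nrad_eq_norm] using h μ
    _ ≤ ‖T + μ • S‖ ^ 2 := by
        gcongr
        · exact nrad_nonneg _
        · exact nrad_le_norm _
end

section
/- Let ε ∈ [0,1) and T, S ∈ B(H). If T² = 0 and T is approximately Birkhoff–James orthogonal to S (‖T + λS‖² ≥ ‖T‖² − 2ε‖T‖‖λS‖ for all λ ∈ ℂ), then T ⊥ε_ω S. -/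
open Filter Topology
open scoped InnerProductSpace

variable {H : Type*} [NormedAddCommGroup H] [InnerProductSpace ℂ H] [CompleteSpace H]

section

variable {E : Type*} [NormedAddCommGroup E] [InnerProductSpace ℂ E]

lemma nrad_nonneg_s2 (T : E →L[ℂ] E) : 0 ≤ nrad T := by
  apply Real.sSup_nonneg
  rintro r ⟨x, -, rfl⟩
  exact norm_nonneg _

lemma norm_inner_map_self_le_nrad (T : E →L[ℂ] E) {x : E} (hx : ‖x‖ = 1) :
    ‖⟪x, T x⟫_ℂ‖ ≤ nrad T := by
  refine le_csSup ⟨‖T‖, ?_⟩ ⟨x, hx, rfl⟩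
  rintro r ⟨y, hy, rfl⟩
  calc ‖⟪y, T y⟫_ℂ‖ ≤ ‖y‖ * ‖T y‖ := norm_inner_le_norm _ _
    _ = ‖T y‖ := by rw [hy, one_mul]
    _ ≤ ‖T‖ := T.unit_le_opNorm y hy.le

lemma norm_inner_map_self_le_nrad_mul_sq (T : E →L[ℂ] E) (x : E) :
    ‖⟪T x, x⟫_ℂ‖ ≤ nrad T * ‖x‖ ^ 2 := by
  rcases eq_or_ne x 0 with rfl | hx
  · simp
  have hpos : 0 < ‖x‖ := norm_pos_iff.mpr hx
  have h := norm_inner_map_self_le_nrad T (norm_smul_inv_norm (𝕜 := ℂ) hx)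
  rw [map_smul, inner_smul_left, inner_smul_right, norm_mul, norm_mul] at h
  simp only [RCLike.norm_conj, norm_inv, RCLike.norm_ofReal, abs_norm] at h
  rw [norm_inner_symm]
  calc ‖⟪x, T x⟫_ℂ‖ = ‖x‖⁻¹ * (‖x‖⁻¹ * ‖⟪x, T x⟫_ℂ‖) * ‖x‖ ^ 2 := by field_simp
    _ ≤ nrad T * ‖x‖ ^ 2 := by gcongr

lemma norm_inner_map_le_nrad (T : E →L[ℂ] E) (x y : E) :
    ‖⟪T x, y⟫_ℂ‖ ≤ nrad T * (‖x‖ ^ 2 + ‖y‖ ^ 2) := by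
  have hpol := inner_map_polarization' (T : E →ₗ[ℂ] E) x y
  simp only [ContinuousLinearMap.coe_coe] at hpol
  have hsum : ‖⟪T x, y⟫_ℂ‖ * 4 ≤ ‖⟪T (x + y), x + y⟫_ℂ‖ + ‖⟪T (x - y), x - y⟫_ℂ‖
      + ‖⟪T (x + Complex.I • y), x + Complex.I • y⟫_ℂ‖
      + ‖⟪T (x - Complex.I • y), x - Complex.I • y⟫_ℂ‖ := by
    rw [hpol, norm_div, Complex.norm_ofNat, div_mul_cancel₀ _ (by norm_num)]
    refine (norm_add_le _ _).trans (add_le_add ((norm_sub_le _ _).trans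
      (add_le_add (norm_sub_le _ _) ?_)) ?_) <;> simp only [norm_mul, Complex.norm_I, one_mul, le_refl]
  have h₁ := norm_inner_map_self_le_nrad_mul_sq T (x + y)
  have h₂ := norm_inner_map_self_le_nrad_mul_sq T (x - y)
  have h₃ := norm_inner_map_self_le_nrad_mul_sq T (x + Complex.I • y)
  have h₄ := norm_inner_map_self_le_nrad_mul_sq T (x - Complex.I • y)
  have hp₁ := parallelogram_law_with_norm ℂ x y
  have hp₂ := parallelogram_law_with_norm ℂ x (Complex.I • y)
  rw [norm_smul, Complex.norm_I, one_mul] at hp₂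
  linear_combination (hsum + h₁ + h₂ + h₃ + h₄ + nrad T * hp₁ + nrad T * hp₂) / 4

/-- The operator norm is at most twice the numerical radius. -/
lemma norm_le_two_mul_nrad (T : E →L[ℂ] E) : ‖T‖ ≤ 2 * nrad T := by
  refine T.opNorm_le_of_unit_norm (mul_nonneg zero_le_two (nrad_nonneg_s2 T)) fun x hx ↦ ?_
  rcases eq_or_ne (T x) 0 with h0 | h0
  · simpa [h0] using nrad_nonneg_s2 T
  have h := norm_inner_map_le_nrad T x (((‖T x‖ : ℂ)⁻¹) • T x)
  have hpos : ‖T x‖ ≠ 0 := norm_ne_zero_iff.mpr h0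
  have hy : ‖((‖T x‖ : ℂ)⁻¹) • T x‖ = 1 := norm_smul_inv_norm h0
  rw [hx, hy, inner_smul_right, norm_mul, norm_inv, Complex.norm_real, norm_norm,
    inner_self_eq_norm_sq_to_K, norm_pow, RCLike.norm_ofReal, abs_norm, inv_mul_eq_div] at h
  have e : ‖T x‖ ^ 2 / ‖T x‖ = ‖T x‖ := by field_simp
  linarith

end

/-- A square-zero operator has numerical radius at most half its norm. -/
lemma two_mul_nrad_le_norm_of_sq_zero {T : H →L[ℂ] H} (hT : T * T = 0) :
    2 * nrad T ≤ ‖T‖ := by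
  suffices h : nrad T ≤ ‖T‖ / 2 by linarith
  refine Real.sSup_le ?_ (by positivity)
  rintro r ⟨x, hx, rfl⟩
  let K : Submodule ℂ H := LinearMap.ker (T : H →ₗ[ℂ] H)
  have : CompleteSpace K := T.isClosed_ker.completeSpace_coe
  obtain ⟨k, hk, y, hy, rfl⟩ := K.exists_add_mem_mem_orthogonal x
  have hTk : T k = 0 := hk
  have hTy : T y ∈ K := by
    change (T * T) y = 0
    simp [hT]
  have hsq := norm_add_sq_eq_norm_sq_add_norm_sq_of_inner_eq_zero k y
    (hy k hk)
  rw [hx] at hsq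
  have hinner : ⟪k + y, T (k + y)⟫_ℂ = ⟪k, T y⟫_ℂ := by
    rw [map_add, hTk, zero_add, inner_add_left, Submodule.inner_left_of_mem_orthogonal hTy hy,
      add_zero]
  calc ‖⟪k + y, T (k + y)⟫_ℂ‖ ≤ ‖k‖ * ‖T y‖ := by
        rw [hinner]
        exact norm_inner_le_norm _ _
    _ ≤ ‖k‖ * (‖T‖ * ‖y‖) := by gcongr; exact T.le_opNorm y
    _ ≤ ‖T‖ / 2 := by
        linear_combination (mul_nonneg (norm_nonneg T) (sq_nonneg (‖k‖ - ‖y‖)) - ‖T‖ * hsq) / 2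

/-- If `T² = 0` and `T` is approximately Birkhoff--James orthogonal to `S`,
then `T ⊥ε_ω S`. -/
theorem BJ_implies_nradOrth_of_sq_zero (ε : ℝ) (hε0 : 0 ≤ ε) (hε1 : ε < 1)
    (T S : H →L[ℂ] H) (hT : T * T = 0)
    (h : ∀ μ : ℂ, ‖T‖ ^ 2 - 2 * ε * ‖T‖ * ‖μ • S‖ ≤ ‖T + μ • S‖ ^ 2) :
    NradOrth ε T S := by
  intro μ
  have hnorm : ‖T‖ = 2 * nrad T :=
    (norm_le_two_mul_nrad T).antisymm (two_mul_nrad_le_norm_of_sq_zero hT)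
  have hsum : ‖T + μ • S‖ ^ 2 ≤ (2 * nrad (T + μ • S)) ^ 2 := by
    gcongr
    exact norm_le_two_mul_nrad _
  have hS := mul_le_mul_of_nonneg_left (norm_le_two_mul_nrad (μ • S))
    (mul_nonneg hε0 (nrad_nonneg_s2 T))
  have hμ := h μ
  rw [hnorm] at hμ
  linarith
end

section
/- Let ε ∈ [0,1) and T, S ∈ B(H). Suppose the Crawford number c(T) = inf{|⟨Tx, x⟩| : ‖x‖ = 1} is nonzero, that T ⊥ε_ω S, and that for every λ ∈ ℂ there exists a sequence (xₙ) of unit vectors in H with |⟨Sxₙ, xₙ⟩| → ω(S), |⟨(T + λS)xₙ, xₙ⟩| → ω(T + λS), and such that the sequences ⟨Txₙ, xₙ⟩ and ⟨Sxₙ, xₙ⟩ converge. Then S ⊥ε_ω T. -/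
open Filter Topology
open scoped InnerProductSpace

variable {H : Type*} [NormedAddCommGroup H] [InnerProductSpace ℂ H] [CompleteSpace H]

/-- The Crawford number of `T`: `c(T) = inf {|⟨Tx, x⟩| : ‖x‖ = 1}`. -/
noncomputable def crawford (T : H →L[ℂ] H) : ℝ :=
  sInf {r : ℝ | ∃ x : H, ‖x‖ = 1 ∧ r = ‖⟪x, T x⟫_ℂ‖}

/-- The values `|⟨Tx, x⟩|` at unit vectors are bounded by the numerical radius. -/
theorem norm_inner_le_nrad (T : H →L[ℂ] H) {x : H} (hx : ‖x‖ = 1) :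
    ‖⟪x, T x⟫_ℂ‖ ≤ nrad T := by
  refine le_csSup ⟨‖T‖, ?_⟩ ⟨x, hx, rfl⟩
  rintro r ⟨y, hy, rfl⟩
  calc ‖⟪y, T y⟫_ℂ‖ ≤ ‖y‖ * ‖T y‖ := norm_inner_le_norm _ _
    _ ≤ ‖T‖ := by simpa [hy] using T.le_opNorm y

/-- The numerical radius is absolutely homogeneous. -/
theorem nrad_smul (μ : ℂ) (T : H →L[ℂ] H) : nrad (μ • T) = ‖μ‖ * nrad T := by
  unfold nrad
  rw [← smul_eq_mul, ← Real.sSup_smul_of_nonneg (norm_nonneg μ)]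
  congr 1
  ext r
  simp only [Set.mem_smul_set, Set.mem_ofPred_eq, smul_eq_mul, smul_apply,
    inner_smul_right, norm_mul]
  constructor
  · rintro ⟨x, hx, rfl⟩
    exact ⟨_, ⟨x, hx, rfl⟩, rfl⟩
  · rintro ⟨_, ⟨x, hx, rfl⟩, rfl⟩
    exact ⟨x, hx, rfl⟩

/-- A joint limit of `⟨Txₙ, xₙ⟩` and `⟨Sxₙ, xₙ⟩` along unit vectors gives a limit for `T + μS`. -/
theorem tendsto_norm_inner_add_smul {T S : H →L[ℂ] H} {x : ℕ → H} {a b : ℂ}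
    (ha : Tendsto (fun n => ⟪x n, T (x n)⟫_ℂ) atTop (𝓝 a))
    (hb : Tendsto (fun n => ⟪x n, S (x n)⟫_ℂ) atTop (𝓝 b)) (μ : ℂ) :
    Tendsto (fun n => ‖⟪x n, (T + μ • S) (x n)⟫_ℂ‖) atTop (𝓝 ‖a + μ * b‖) := by
  simpa [inner_add_right, inner_smul_right] using (ha.add (hb.const_mul μ)).norm

/-- Expansions of `|a + tλ̄b|²` and `|b + λa|²` have proportional cross terms. -/
theorem mul_norm_add_mul_sq (a b l : ℂ) (t : ℝ) :
    t * ‖b + l * a‖ ^ 2 = ‖a + (t * (starRingEnd ℂ) l) * b‖ ^ 2 - ‖a‖ ^ 2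
      + t * ‖b‖ ^ 2 + t * ‖l‖ ^ 2 * ‖a‖ ^ 2 - t ^ 2 * ‖l‖ ^ 2 * ‖b‖ ^ 2 := by
  simp only [Complex.sq_norm, Complex.normSq_apply, Complex.add_re, Complex.add_im,
    Complex.mul_re, Complex.mul_im, Complex.conj_re, Complex.conj_im, Complex.ofReal_re,
    Complex.ofReal_im]
  ring

/-- If `c(T) ≠ 0`, `T ⊥ε_ω S`, and for every `λ ∈ ℂ` there is a sequence of
unit vectors at which `S` and `T + λS` attain their numerical radii in the limit and along
which `⟨Txₙ, xₙ⟩` and `⟨Sxₙ, xₙ⟩` converge, then `S ⊥ε_ω T`. -/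
theorem nradOrth_symm_of_crawford (ε : ℝ) (hε0 : 0 ≤ ε) (hε1 : ε < 1)
    (T S : H →L[ℂ] H) (hc : crawford T ≠ 0) (h : NradOrth ε T S)
    (hseq : ∀ μ : ℂ, ∃ x : ℕ → H,
      (∀ n, ‖x n‖ = 1) ∧
      Tendsto (fun n => ‖⟪x n, S (x n)⟫_ℂ‖) atTop (𝓝 (nrad S)) ∧
      Tendsto (fun n => ‖⟪x n, (T + μ • S) (x n)⟫_ℂ‖) atTop (𝓝 (nrad (T + μ • S))) ∧
      (∃ a : ℂ, Tendsto (fun n => ⟪x n, T (x n)⟫_ℂ) atTop (𝓝 a)) ∧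
      (∃ b : ℂ, Tendsto (fun n => ⟪x n, S (x n)⟫_ℂ) atTop (𝓝 b))) :
    NradOrth ε S T := by
  intro l
  have key : ∀ t : ℝ, 0 < t →
      nrad S ^ 2 - 2 * ε * nrad S * nrad (l • T) - t * (‖l‖ ^ 2 * nrad S ^ 2)
        ≤ nrad (S + l • T) ^ 2 := by
    intro t ht
    obtain ⟨x, hx, hS, hTS, ⟨a, ha⟩, b, hb⟩ := hseq (t * (starRingEnd ℂ) l)
    have hbS : ‖b‖ = nrad S := tendsto_nhds_unique hb.norm hS
    have hab := tendsto_nhds_unique (tendsto_norm_inner_add_smul ha hb _) hTS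
    have haT : ‖a‖ ≤ nrad T := le_of_tendsto' ha.norm fun n => norm_inner_le_nrad T (hx n)
    have hba : ‖b + l * a‖ ≤ nrad (S + l • T) :=
      le_of_tendsto' (tendsto_norm_inner_add_smul hb ha l) fun n => norm_inner_le_nrad _ (hx n)
    have horth := h (t * (starRingEnd ℂ) l)
    have hid := mul_norm_add_mul_sq a b l t
    have hnorm : ‖(t : ℂ) * (starRingEnd ℂ) l‖ = t * ‖l‖ := by simp [abs_of_pos ht]
    rw [nrad_smul, hnorm, ← hab] at horth
    rw [hbS] at hid
    have haT2 : ‖a‖ ^ 2 ≤ nrad T ^ 2 := by gcongr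
    have hpos : 0 ≤ t * ‖l‖ ^ 2 * ‖a‖ ^ 2 := by positivity
    refine le_trans ?_ (pow_le_pow_left₀ (norm_nonneg _) hba 2)
    rw [nrad_smul]
    refine le_of_mul_le_mul_left ?_ ht
    linarith
  have hlim : Tendsto (fun t : ℝ => nrad S ^ 2 - 2 * ε * nrad S * nrad (l • T)
      - t * (‖l‖ ^ 2 * nrad S ^ 2)) (𝓝[>] 0)
      (𝓝 (nrad S ^ 2 - 2 * ε * nrad S * nrad (l • T))) := by
    refine Tendsto.mono_left (Continuous.tendsto' (by fun_prop) _ _ (by simp)) nhdsWithin_le_nhds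
  exact le_of_tendsto hlim (eventually_mem_nhdsWithin.mono key)
end

section
/- Let T, S ∈ B(H) and let θ ∈ [0, 2π) be fixed. Suppose that for every r > 0 there exists a sequence (xₙ^r) of unit vectors in H such that |⟨Txₙ^r, xₙ^r⟩| → ω(T), |⟨(T + r e^{iθ}S)xₙ^r, xₙ^r⟩| → ω(T + r e^{iθ}S), and the sequence Re(e^{−iθ}⟨Txₙ^r, xₙ^r⟩·conj(⟨Sxₙ^r, xₙ^r⟩)) converges as n → ∞, with limit L(r). Then D^θ_ω(T, S) = lim_{r→0⁺} L(r). -/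
open Filter Topology
open scoped InnerProductSpace

variable {H : Type*} [NormedAddCommGroup H] [InnerProductSpace ℂ H] [CompleteSpace H]

/-- The cross term in the expansion of `‖t + r e^{iθ} s‖ ^ 2`. -/
lemma norm_add_mul_exp_mul_sq (t s : ℂ) (r θ : ℝ) :
    ‖t + ((r : ℂ) * Complex.exp ((θ : ℂ) * Complex.I)) * s‖ ^ 2 =
      ‖t‖ ^ 2 + 2 * r * (Complex.exp (-(θ : ℂ) * Complex.I) * t * (starRingEnd ℂ) s).re +
        r ^ 2 * ‖s‖ ^ 2 := by
  have hconj : (starRingEnd ℂ) (Complex.exp ((θ : ℂ) * Complex.I)) =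
      Complex.exp (-(θ : ℂ) * Complex.I) := by
    rw [← Complex.exp_conj]
    simp
  have hre : (t * (starRingEnd ℂ) ((r : ℂ) * Complex.exp ((θ : ℂ) * Complex.I) * s)).re =
      r * (Complex.exp (-(θ : ℂ) * Complex.I) * t * (starRingEnd ℂ) s).re := by
    rw [← Complex.re_ofReal_mul, map_mul, map_mul, hconj, Complex.conj_ofReal]
    congr 1
    ring
  have hnorm : ‖(r : ℂ) * Complex.exp ((θ : ℂ) * Complex.I) * s‖ ^ 2 = r ^ 2 * ‖s‖ ^ 2 := by
    rw [norm_mul, norm_mul, Complex.norm_exp_ofReal_mul_I, Complex.norm_real, mul_one, mul_pow,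
      Real.norm_eq_abs, sq_abs]
  rw [Complex.sq_norm, Complex.normSq_add, hre, ← Complex.sq_norm, ← Complex.sq_norm, hnorm]
  ring

lemma norm_inner_apply_le_opNorm {E : Type*} [NormedAddCommGroup E] [InnerProductSpace ℂ E]
    (S : E →L[ℂ] E) {x : E} (hx : ‖x‖ = 1) :
    ‖⟪x, S x⟫_ℂ‖ ≤ ‖S‖ := by
  have h := (norm_inner_le_norm (𝕜 := ℂ) x (S x)).trans
    (mul_le_mul_of_nonneg_left (S.le_opNorm x) (norm_nonneg x))
  simpa [hx] using h

/-- If for every `r > 0` there is a sequence of unit vectors `xₙ^r` at which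
both `T` and `T + r e^{iθ} S` attain their numerical radii in the limit, and along which
`Re(e^{−iθ}⟨Txₙ^r, xₙ^r⟩ conj(⟨Sxₙ^r, xₙ^r⟩))` converges to `L(r)`, then
`D^θ_ω(T, S) = lim_{r→0⁺} L(r)`. -/
theorem nrad_deriv_eq_lim_seq (T S : H →L[ℂ] H) (θ : ℝ)
    (hθ : θ ∈ Set.Ico (0 : ℝ) (2 * Real.pi)) (L : ℝ → ℝ)
    (hL : ∀ r : ℝ, 0 < r → ∃ x : ℕ → H,
      (∀ n, ‖x n‖ = 1) ∧
      Tendsto (fun n => ‖⟪x n, T (x n)⟫_ℂ‖) atTop (𝓝 (nrad T)) ∧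
      Tendsto
        (fun n =>
          ‖⟪x n, (T + ((r : ℂ) * Complex.exp ((θ : ℂ) * Complex.I)) • S) (x n)⟫_ℂ‖)
        atTop (𝓝 (nrad (T + ((r : ℂ) * Complex.exp ((θ : ℂ) * Complex.I)) • S))) ∧
      Tendsto
        (fun n =>
          (Complex.exp (-(θ : ℂ) * Complex.I) * ⟪x n, T (x n)⟫_ℂ *
            (starRingEnd ℂ) ⟪x n, S (x n)⟫_ℂ).re)
        atTop (𝓝 (L r)))
    (D : ℝ)
    (hD : Tendsto
      (fun r : ℝ =>
        (nrad (T + ((r : ℂ) * Complex.exp ((θ : ℂ) * Complex.I)) • S) ^ 2 - nrad T ^ 2) /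
          (2 * r))
      (𝓝[>] (0 : ℝ)) (𝓝 D)) :
    Tendsto L (𝓝[>] (0 : ℝ)) (𝓝 D) := by
  have key : ∀ r : ℝ, 0 < r →
      (nrad (T + ((r : ℂ) * Complex.exp ((θ : ℂ) * Complex.I)) • S) ^ 2 - nrad T ^ 2) / (2 * r) -
          r * ‖S‖ ^ 2 / 2 ≤ L r ∧
        L r ≤
          (nrad (T + ((r : ℂ) * Complex.exp ((θ : ℂ) * Complex.I)) • S) ^ 2 - nrad T ^ 2) /
            (2 * r) := by
    intro r hr
    obtain ⟨x, hx, hT, hTS, hLr⟩ := hL r hr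
    have hdiff := (hTS.pow 2).sub (hT.pow 2)
    have hcross := hLr.const_mul (2 * r)
    have hexpand : ∀ n, ‖⟪x n, (T + ((r : ℂ) * Complex.exp ((θ : ℂ) * Complex.I)) • S) (x n)⟫_ℂ‖ ^ 2
        = ‖⟪x n, T (x n)⟫_ℂ‖ ^ 2 +
          2 * r * (Complex.exp (-(θ : ℂ) * Complex.I) * ⟪x n, T (x n)⟫_ℂ *
            (starRingEnd ℂ) ⟪x n, S (x n)⟫_ℂ).re + r ^ 2 * ‖⟪x n, S (x n)⟫_ℂ‖ ^ 2 := by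
      intro n
      rw [← norm_add_mul_exp_mul_sq, add_apply,
        smul_apply, inner_add_right, inner_smul_right]
    have hlower := le_of_tendsto_of_tendsto' hcross hdiff fun n => by
      rw [hexpand n]
      have : 0 ≤ r ^ 2 * ‖⟪x n, S (x n)⟫_ℂ‖ ^ 2 := by positivity
      linarith
    have hupper := le_of_tendsto_of_tendsto' hdiff (hcross.add_const (r ^ 2 * ‖S‖ ^ 2))
      fun n => by
        rw [hexpand n]
        have : r ^ 2 * ‖⟪x n, S (x n)⟫_ℂ‖ ^ 2 ≤ r ^ 2 * ‖S‖ ^ 2 := by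
          gcongr
          exact norm_inner_apply_le_opNorm S (hx n)
        linarith
    constructor
    · rw [sub_le_iff_le_add, div_le_iff₀ (by positivity)]
      linarith
    · rw [le_div_iff₀ (by positivity)]
      linarith
  have herr : Tendsto (fun r : ℝ => r * ‖S‖ ^ 2 / 2) (𝓝[>] 0) (𝓝 0) := by
    have hcont : Continuous fun r : ℝ => r * ‖S‖ ^ 2 / 2 := by fun_prop
    simpa using (hcont.tendsto 0).mono_left nhdsWithin_le_nhds
  refine tendsto_of_tendsto_of_tendsto_of_le_of_le' (by simpa using hD.sub herr) hD ?_ ?_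
  · filter_upwards [self_mem_nhdsWithin] with r hr using (key r hr).1
  · filter_upwards [self_mem_nhdsWithin] with r hr using (key r hr).2
end
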